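/- Let c > 0 be real, let s ∈ ℂ with Re s > 0, let r ∈ ℝ, and let β ∈ ℂ satisfy Re β > 0 and β² = c s² + r². Then Re( conj(s) · β ) > 0. -/

import Mathlib

open ComplexConjugate

/-- If `c > 0`, `Re s > 0`, `r ∈ ℝ`, and `β` is the square root with positive
real part of `c s² + r²`, then `Re(conj s · β) > 0`. -/
theorem stmt_5 (c : ℝ) (hc : 0 < c) (s : ℂ) (hs : 0 < s.re) (r : ℝ) (β : ℂ)
    (hβre : 0 < β.re) (hβ : β ^ 2 = (c : ℂ) * s ^ 2 + (r ^ 2 : ℝ)) :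
    0 < (conj s * β).re := by
  have him : β.re * β.im = c * (s.re * s.im) := by
    have h := congrArg Complex.im hβ
    simp only [pow_two, Complex.add_im, Complex.mul_im, Complex.mul_re, Complex.ofReal_re,
      Complex.ofReal_im] at h
    linarith
  have hre : (conj s * β).re = s.re * β.re + s.im * β.im := by
    simp [Complex.mul_re]
  have hmul : β.re * (s.re * β.re + s.im * β.im) = s.re * (β.re ^ 2 + c * s.im ^ 2) := by
    linear_combination s.im * him
  rw [hre]
  refine pos_of_mul_pos_right ?_ hβre.le
  rw [hmul]
  positivity
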